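/- arXiv:1311.1803 — 2 statements merged into one kernel-verified Lean document; each statement's English description precedes it below -/
import Mathlib

section
/- Let σ′ be a coalitional deviation from an NE assignment σ of a load balancing game. Then every participating server has out-degree at least 1 in the deviation graph (i.e., for every participating server i some coalition job j has σ(j) = i), and consequently every participating server holds at least two jobs under σ. -/
/-- The workload of server `i` under assignment `σ`. -/
def load {n m : ℕ} (p : Fin n → ℝ) (σ : Fin n → Fin m) (i : Fin m) : ℝ :=
  ∑ j ∈ Finset.univ.filter (fun j => σ j = i), p j

/-- `σ` is a Nash equilibrium assignment. -/
def IsNE {n m : ℕ} (p : Fin n → ℝ) (σ : Fin n → Fin m) : Prop :=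
  ∀ j i, load p σ (σ j) ≤ load p σ i + p j

/-- `σ'` is a coalitional deviation from `σ`. -/
def IsDeviation {n m : ℕ} (p : Fin n → ℝ) (σ σ' : Fin n → Fin m) : Prop :=
  (∃ j, σ' j ≠ σ j) ∧ ∀ j, σ' j ≠ σ j → load p σ' (σ' j) < load p σ (σ j)

/-- Server `i` participates in the deviation: its job set changes. -/
def Participates {n m : ℕ} (σ σ' : Fin n → Fin m) (i : Fin m) : Prop :=
  {j | σ j = i} ≠ {j | σ' j = i}

/-- A job processed on server `i` contributes at least its own length to the load of `i`. -/
theorem le_load {n m : ℕ} {p : Fin n → ℝ} (hp : ∀ j, 0 < p j) {σ : Fin n → Fin m}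
    {i : Fin m} {j : Fin n} (hj : σ j = i) : p j ≤ load p σ i :=
  Finset.single_le_sum (fun k _ => (hp k).le) (by simp [hj])

/-- If every job of server `i` stays and the job `j` joins, the load of `i` grows by at least
`p j`. -/
theorem load_add_le_load_of_join {n m : ℕ} {p : Fin n → ℝ} (hp : ∀ j, 0 < p j)
    {σ σ' : Fin n → Fin m} {i : Fin m} {j : Fin n} (hstay : ∀ k, σ k = i → σ' k = i)
    (hj : σ j ≠ i) (hj' : σ' j = i) : load p σ i + p j ≤ load p σ' i := by
  have hmem : j ∉ Finset.univ.filter (fun k => σ k = i) := by simp [hj]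
  rw [load, add_comm, ← Finset.sum_insert hmem]
  refine Finset.sum_le_sum_of_subset_of_nonneg ?_ fun k _ _ => (hp k).le
  intro k hk
  rcases Finset.mem_insert.mp hk with rfl | hk
  · simp [hj']
  · simpa using hstay k (by simpa using hk)

/-- In a coalitional deviation from a Nash equilibrium, some job leaves each participating
server. -/
theorem exists_leaving_job {n m : ℕ} {p : Fin n → ℝ} (hp : ∀ j, 0 < p j)
    {σ σ' : Fin n → Fin m} (hNE : IsNE p σ) (hdev : IsDeviation p σ σ')
    {i : Fin m} (hi : Participates σ σ' i) : ∃ j, σ' j ≠ σ j ∧ σ j = i := by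
  by_contra! h
  have hstay : ∀ k, σ k = i → σ' k = i := fun k hk => by
    by_contra hk'
    exact h k (fun e => hk' (e.trans hk)) hk
  refine hi (Set.Subset.antisymm hstay fun j (hj' : σ' j = i) => ?_)
  by_contra hj
  replace hj : σ j ≠ i := hj
  have hlt := hdev.2 j (fun e => hj (e.symm.trans hj'))
  rw [hj'] at hlt
  linarith [hNE j i, load_add_le_load_of_join hp hstay hj hj']

/-- Every participating server has out-degree at least 1 in the deviation graph
(some coalition job leaves it), and holds at least two jobs under `σ`. -/
theorem participating_server_outdeg_ge_one {n m : ℕ}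
    (p : Fin n → ℝ) (hp : ∀ j, 0 < p j)
    (σ : Fin n → Fin m) (hNE : IsNE p σ)
    (σ' : Fin n → Fin m) (hdev : IsDeviation p σ σ')
    (i : Fin m) (hi : Participates σ σ' i) :
    (∃ j, σ' j ≠ σ j ∧ σ j = i) ∧
      2 ≤ (Finset.univ.filter (fun j => σ j = i)).card := by
  obtain ⟨j, hj, rfl⟩ := exists_leaving_job hp hNE hdev hi
  refine ⟨⟨j, hj, rfl⟩, ?_⟩
  by_contra! hcard
  have hmem : j ∈ Finset.univ.filter (fun k => σ k = σ j) := by simp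
  have hload : load p σ (σ j) = p j := by
    rw [load, Finset.eq_singleton_iff_unique_mem.mpr ⟨hmem, fun k hk =>
      Finset.card_le_one.mp (Nat.lt_succ_iff.mp hcard) k hk j hmem⟩, Finset.sum_singleton]
  linarith [hdev.2 j hj, le_load hp (σ := σ') (j := j) rfl]
end

section
/- Let σ′ be a coalitional deviation from an NE assignment σ of an m-server load balancing game in which all m servers participate, let Ã be a tilde-valid arc subset of the deviation graph's arc set A, and let b_i be the out-degree of server i in Ã. Then IR(σ′) · Σ_{i=1}^m L_σ(i) ≤ Σ_{i=1}^m b_i · L_σ(i); equivalently, IR(σ′) ≤ (Σ_i b_i L_σ(i)) / (Σ_i L_σ(i)). -/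
/-- The improvement ratio of a coalitional deviation. -/
noncomputable def IR {n m : ℕ} (p : Fin n → ℝ) (σ σ' : Fin n → Fin m) : ℝ :=
  sInf {r | ∃ j, σ' j ≠ σ j ∧ r = load p σ (σ j) / load p σ' (σ' j)}

/-- `(u,v)` is an arc of the deviation graph. -/
def Arc {n m : ℕ} (σ σ' : Fin n → Fin m) (u v : Fin m) : Prop :=
  ∃ j, σ' j ≠ σ j ∧ σ j = u ∧ σ' j = v

/-- An arc subset `At ⊆ A` is tilde-valid if every server has exactly one
incoming arc in `At`. -/
def TildeValid {n m : ℕ} (σ σ' : Fin n → Fin m) (At : Finset (Fin m × Fin m)) : Prop :=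
  (∀ e ∈ At, Arc σ σ' e.1 e.2) ∧
    ∀ i : Fin m, (At.filter (fun e => e.2 = i)).card = 1

/-- The out-degree `b_i` of server `i` in the arc subset `At`. -/
def outDeg {m : ℕ} (At : Finset (Fin m × Fin m)) (i : Fin m) : ℕ :=
  (At.filter (fun e => e.1 = i)).card

theorem load_pos {n m : ℕ} {p : Fin n → ℝ} (hp : ∀ j, 0 < p j) (σ : Fin n → Fin m)
    (j : Fin n) : 0 < load p σ (σ j) :=
  Finset.sum_pos (fun i _ => hp i) ⟨j, by simp⟩

theorem sum_load {n m : ℕ} (p : Fin n → ℝ) (σ : Fin n → Fin m) :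
    ∑ i, load p σ i = ∑ j, p j :=
  Finset.sum_fiberwise _ _ _

theorem IR_mul_load_le_of_arc {n m : ℕ} {p : Fin n → ℝ} (hp : ∀ j, 0 < p j)
    {σ σ' : Fin n → Fin m} {u v : Fin m} (h : Arc σ σ' u v) :
    IR p σ σ' * load p σ' v ≤ load p σ u := by
  obtain ⟨j, hj, rfl, rfl⟩ := h
  rw [← le_div_iff₀ (load_pos hp σ' j)]
  refine csInf_le ⟨0, ?_⟩ ⟨j, hj, rfl⟩
  rintro _ ⟨k, -, rfl⟩
  exact (div_pos (load_pos hp σ k) (load_pos hp σ' k)).le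

theorem sum_comp_eq_sum_card_mul {α β : Type*} [Fintype β] [DecidableEq β] (s : Finset α)
    (g : α → β) (f : β → ℝ) :
    ∑ e ∈ s, f (g e) = ∑ i, ((s.filter (fun e => g e = i)).card : ℝ) * f i := by
  rw [← Finset.sum_fiberwise' s g f]
  simp

/-- For a coalitional deviation from an NE involving all `m` servers and any
tilde-valid arc subset with out-degrees `b_i`, we have
`IR(σ') · Σ_i L_σ(i) ≤ Σ_i b_i · L_σ(i)`. -/
theorem IR_bound_by_tilde_valid_arcs {n m : ℕ}
    (p : Fin n → ℝ) (hp : ∀ j, 0 < p j)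
    (σ : Fin n → Fin m) (hNE : IsNE p σ)
    (σ' : Fin n → Fin m) (hdev : IsDeviation p σ σ')
    (hall : ∀ i, Participates σ σ' i)
    (At : Finset (Fin m × Fin m)) (htv : TildeValid σ σ' At) :
    IR p σ σ' * ∑ i, load p σ i ≤ ∑ i, (outDeg At i : ℝ) * load p σ i := by
  calc IR p σ σ' * ∑ i, load p σ i
      = IR p σ σ' * ∑ e ∈ At, load p σ' e.2 := by
        rw [sum_load, ← sum_load p σ', sum_comp_eq_sum_card_mul At Prod.snd]
        simp [htv.2]
    _ ≤ ∑ e ∈ At, load p σ e.1 := by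
        rw [Finset.mul_sum]
        exact Finset.sum_le_sum fun e he => IR_mul_load_le_of_arc hp (htv.1 e he)
    _ = ∑ i, (outDeg At i : ℝ) * load p σ i := sum_comp_eq_sum_card_mul _ _ _
end
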